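/- arXiv:1810.03093 — 3 statements merged into one kernel-verified Lean document; each statement's English description precedes it below -/
import Mathlib

section
/- Let $n\in\mathbb{N}\cup\{0\}$ and let $s\in\mathbb{C}$ with $\frac12<\mathrm{Re}(s)<1$. Then the function $x\mapsto {}_1F_1\!\left(\frac12;\frac12-n;-x\right)x^{s-\frac32}$ is integrable on $(0,\infty)$. -/
open Complex MeasureTheory Filter

noncomputable section

/-- Pochhammer symbol (a)_m = a(a+1)...(a+m-1). -/
def poch (a : ℂ) (m : ℕ) : ℂ := ∏ i ∈ Finset.range m, (a + i)

/-- Confluent hypergeometric function ₁F₁(a;c;z). -/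
def hyp1F1 (a c z : ℂ) : ℂ := ∑' m : ℕ, poch a m / (poch c m * (m.factorial : ℂ)) * z ^ m

/-- Humbert function Φ₃(a;c;x,y). -/
def Phi3 (a c x y : ℂ) : ℂ :=
  ∑' p : ℕ × ℕ,
    poch a p.1 / (poch c (p.1 + p.2) * (p.1.factorial : ℂ) * (p.2.factorial : ℂ))
      * x ^ p.1 * y ^ p.2

/-- Generalized hypergeometric function ₂F₂(a₁,a₂;b₁,b₂;z). -/
def hyp2F2 (a₁ a₂ b₁ b₂ z : ℂ) : ℂ :=
  ∑' m : ℕ, poch a₁ m * poch a₂ m / (poch b₁ m * poch b₂ m * (m.factorial : ℂ)) * z ^ m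

/-- Error function, extended to complex arguments along the segment from 0 to w. -/
def cerf (w : ℂ) : ℂ :=
  2 / (Real.sqrt Real.pi : ℂ) * ∫ t in (0:ℝ)..1, w * Complex.exp (-(((t:ℂ) * w) ^ 2))

/-- Imaginary error function, extended to complex arguments. -/
def cerfi (w : ℂ) : ℂ :=
  2 / (Real.sqrt Real.pi : ℂ) * ∫ t in (0:ℝ)..1, w * Complex.exp (((t:ℂ) * w) ^ 2)

/-- Contour integral along the vertical line Re(s) = c : ∫_{(c)} f(s) ds. -/
def lineInt (c : ℝ) (f : ℂ → ℂ) : ℂ := Complex.I * ∫ t : ℝ, f (c + t * Complex.I)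

/-- Generalized modified Bessel function K_{z,w}(x), defined with contour Re(s)=c. -/
def Kzw (z w x : ℂ) (c : ℝ) : ℂ :=
  (2 * (Real.pi : ℂ) * Complex.I)⁻¹ *
    lineInt c (fun s =>
      Complex.Gamma ((s - z) / 2) * Complex.Gamma ((s + z) / 2) *
        hyp1F1 ((s - z) / 2) (1/2) (-w^2 / 4) * hyp1F1 ((s + z) / 2) (1/2) (-w^2 / 4) *
        (2:ℂ) ^ (s - 2) * x ^ (-s))

/-- Divisor function σ₋₁(n) = ∑_{d ∣ n} 1/d. -/
def sigmaNegOne (n : ℕ) : ℝ := ∑ d ∈ n.divisors, (d : ℝ)⁻¹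

/-- Gaussian density. -/
def gauss (σ x : ℝ) : ℝ := Real.exp (-(x^2) / (2 * σ^2)) / (σ * Real.sqrt (2 * Real.pi))

/-- Lorentzian density. -/
def lorentz (β x : ℝ) : ℝ := β / (Real.pi * (x^2 + β^2))

/-- Voigt profile: convolution of Gaussian and Lorentzian. -/
def voigt (σ β x : ℝ) : ℝ := ∫ t : ℝ, gauss σ t * lorentz β (x - t)

/-- Faddeeva function ξ(y) = e^{-y²}(1 - erf(-iy)). -/
def faddeeva (y : ℂ) : ℂ := Complex.exp (-y^2) * (1 - cerf (-Complex.I * y))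

open Polynomial in
/-- `∑ₘ (a + m)ₙ zᵐ / m!` is a polynomial in `z` times `exp z`. -/
theorem exists_polynomial_hasSum_poch (n : ℕ) (a : ℂ) :
    ∃ Q : ℂ[X], ∀ z : ℂ,
      HasSum (fun m : ℕ => poch (a + m) n / (m.factorial : ℂ) * z ^ m)
        (Q.eval z * Complex.exp z) := by
  induction n generalizing a with
  | zero =>
    refine ⟨1, fun z => ?_⟩
    have h := NormedSpace.expSeries_div_hasSum_exp z
    rw [← Complex.exp_eq_exp_ℂ] at h
    simpa [poch, div_eq_inv_mul] using h
  | succ n ih =>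
    obtain ⟨Q₁, h₁⟩ := ih (a + 1)
    obtain ⟨Q₂, h₂⟩ := ih (a + 2)
    refine ⟨C a * Q₁ + X * Q₂, fun z => ?_⟩
    have hshift : HasSum
        (fun m : ℕ => (m : ℂ) * (poch (a + 1 + m) n / (m.factorial : ℂ) * z ^ m))
        (z * (Q₂.eval z * Complex.exp z)) := by
      rw [← hasSum_nat_add_iff' 1]
      simp only [Finset.sum_range_one, Nat.cast_zero, zero_mul, sub_zero]
      convert! (h₂ z).mul_left z using 1
      funext m
      have hm : (m : ℂ) + 1 ≠ 0 := Nat.cast_add_one_ne_zero m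
      have hf : (m.factorial : ℂ) ≠ 0 := Nat.cast_ne_zero.mpr m.factorial_ne_zero
      have ha : a + 1 + ((m + 1 : ℕ) : ℂ) = a + 2 + m := by push_cast; ring
      rw [ha, Nat.factorial_succ]
      push_cast
      field_simp
      ring
    convert! ((h₁ z).mul_left a).add hshift using 1
    · funext m
      have hp : poch (a + m) (n + 1) = (a + m) * poch (a + 1 + m) n := by
        simp only [poch, Finset.prod_range_succ', Nat.cast_zero, add_zero]
        rw [mul_comm]
        congr 1
        refine Finset.prod_congr rfl fun i _ => ?_
        push_cast
        ring
      rw [hp]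
      ring
    · simp only [eval_add, eval_mul, eval_C, eval_X]
      ring

theorem poch_add (a : ℂ) (m k : ℕ) : poch a (m + k) = poch a m * poch (a + m) k := by
  simp only [poch, Finset.prod_range_add, Nat.cast_add, add_assoc]

theorem poch_half_sub_ne_zero (n m : ℕ) : poch (1 / 2 - (n : ℂ)) m ≠ 0 := by
  refine Finset.prod_ne_zero_iff.mpr fun i _ h => ?_
  have h' : ((1 + 2 * i : ℕ) : ℂ) = ((2 * n : ℕ) : ℂ) := by
    push_cast
    linear_combination 2 * h
  have := Nat.cast_injective h'
  omega

open Polynomial in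
/-- `₁F₁(1/2; 1/2 - n; z)` is a polynomial in `z` times `exp z`. -/
theorem exists_polynomial_hyp1F1_half (n : ℕ) :
    ∃ Q : ℂ[X], ∀ z : ℂ, hyp1F1 (1 / 2) (1 / 2 - (n : ℂ)) z = Q.eval z * Complex.exp z := by
  obtain ⟨Q, hQ⟩ := exists_polynomial_hasSum_poch n (1 / 2 - (n : ℂ))
  refine ⟨C (poch (1 / 2 - (n : ℂ)) n)⁻¹ * Q, fun z => ?_⟩
  rw [eval_mul, eval_C, mul_assoc, ← ((hQ z).mul_left _).tsum_eq, hyp1F1]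
  refine tsum_congr fun m => ?_
  have h := poch_add (1 / 2 - (n : ℂ)) n m
  rw [add_comm n m, poch_add, sub_add_cancel] at h
  have hn := poch_half_sub_ne_zero n n
  have hm := poch_half_sub_ne_zero n m
  have hq : poch (1 / 2) m / poch (1 / 2 - (n : ℂ)) m
      = (poch (1 / 2 - (n : ℂ)) n)⁻¹ * poch (1 / 2 - (n : ℂ) + m) n := by
    rw [div_eq_iff hm, mul_assoc, mul_comm (poch (_ + _) n), h, inv_mul_cancel_left₀ hn]
  rw [← div_div, hq]
  ring

open Polynomial in
theorem integrableOn_polynomial_mul_exp_neg_mul_cpow (Q : ℂ[X]) {t : ℂ} (ht : 0 < t.re) :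
    IntegrableOn (fun x : ℝ => Q.eval (-(x : ℂ)) * Complex.exp (-(x : ℂ)) * (x : ℂ) ^ (t - 1))
      (Set.Ioi 0) := by
  induction Q using Polynomial.induction_on' with
  | add p q hp hq =>
    simp only [eval_add, add_mul]
    exact hp.add hq
  | monomial k c =>
    have hk : 0 < (t + k).re := by
      rw [add_re, natCast_re]
      positivity
    refine IntegrableOn.congr_fun ((GammaIntegral_convergent hk).const_mul (c * (-1) ^ k))
      (fun x hx => ?_) measurableSet_Ioi
    have hx0 : (x : ℂ) ≠ 0 := ofReal_ne_zero.mpr (ne_of_gt hx)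
    have he : t + k - 1 = t - 1 + k := by ring
    simp only [eval_monomial, he, cpow_add _ _ hx0, cpow_natCast, neg_pow (x : ℂ) k]
    push_cast
    ring

/-- integrability of `x ↦ ₁F₁(1/2; 1/2 - n; -x) x^{s - 3/2}` on `(0,∞)`. -/
theorem integrable_1F1_mellin (n : ℕ) (s : ℂ) (hs1 : 1/2 < s.re) (hs2 : s.re < 1) :
    MeasureTheory.IntegrableOn
      (fun x : ℝ => hyp1F1 (1/2) (1/2 - (n:ℂ)) (-(x:ℂ)) * (x:ℂ) ^ (s - 3/2))
      (Set.Ioi 0) := by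
  obtain ⟨Q, hQ⟩ := exists_polynomial_hyp1F1_half n
  have ht : 0 < (s - 1 / 2).re := by
    norm_num
    linarith
  have he : s - 3 / 2 = s - 1 / 2 - 1 := by ring
  simp only [hQ, he]
  exact integrableOn_polynomial_mul_exp_neg_mul_cpow Q ht

end
end

section
/- Let $w\in\mathbb{C}$ and let $a,b$ be positive real numbers. Then $\lim_{z\to 1}\frac14\,\Gamma\!\left(\frac{z}{2}\right)\zeta(z)\left\{b^{\frac{1-z}{2}}\,{}_1F_1\!\left(\frac{1-z}{2};\frac12;\frac{w^2}{4}\right)-a^{\frac{1-z}{2}}\,{}_1F_1\!\left(\frac{1-z}{2};\frac12;-\frac{w^2}{4}\right)\right\}=\frac{\sqrt{\pi}}{8}\left[\log\frac{a}{b}-\frac{w^2}{2}\left({}_2F_2\!\left(1,1;\frac32,2;\frac{w^2}{4}\right)+{}_2F_2\!\left(1,1;\frac32,2;-\frac{w^2}{4}\right)\right)\right]$. -/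
open Complex MeasureTheory Filter

noncomputable section

open scoped Topology

lemma poch_succ_left (a : ℂ) (m : ℕ) : poch a (m + 1) = a * poch (a + 1) m := by
  rw [poch, Finset.prod_range_succ', mul_comm, poch]
  congr 1
  · simp
  · refine Finset.prod_congr rfl fun i _ => ?_
    push_cast
    ring

lemma poch_one (m : ℕ) : poch 1 m = m.factorial := by
  induction m with
  | zero => simp [poch]
  | succ n ih =>
    rw [poch, Finset.prod_range_succ, ← poch, ih, Nat.factorial_succ]
    push_cast
    ring

lemma poch_two (m : ℕ) : poch 2 m = (m + 1).factorial := by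
  rw [← poch_one, poch_succ_left, one_mul, one_add_one_eq_two]

lemma norm_poch_add_one_le {e : ℂ} (he : ‖e‖ ≤ 1) (m : ℕ) :
    ‖poch (e + 1) m‖ ≤ (m + 1).factorial := by
  rw [poch, norm_prod, ← Finset.prod_range_add_one_eq_factorial, Finset.prod_range_succ',
    Nat.cast_mul, Nat.cast_prod]
  simp only [zero_add, Nat.cast_one, mul_one]
  refine Finset.prod_le_prod (fun _ _ => norm_nonneg _) fun i _ => ?_
  calc ‖e + 1 + i‖ ≤ ‖e‖ + ‖(1 : ℂ)‖ + ‖(i : ℂ)‖ := norm_add₃_le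
    _ ≤ ((i + 1 + 1 : ℕ) : ℝ) := by
      rw [norm_one, Complex.norm_natCast]
      push_cast
      linarith

lemma factorial_le_norm_poch_three_halves (m : ℕ) : (m.factorial : ℝ) ≤ ‖poch (3 / 2) m‖ := by
  rw [poch, norm_prod, ← Finset.prod_range_add_one_eq_factorial, Nat.cast_prod]
  refine Finset.prod_le_prod (fun _ _ => Nat.cast_nonneg _) fun i _ => ?_
  refine le_trans ?_ (Complex.re_le_norm _)
  simp
  linarith

lemma poch_half_succ (m : ℕ) : poch (1 / 2) (m + 1) = 1 / 2 * poch (3 / 2) m := by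
  rw [poch_succ_left]
  norm_num

/-- The terms of the series `(₁F₁(e; 1/2; x) - 1) / e`. -/
def quotTerm (x e : ℂ) (m : ℕ) : ℂ :=
  poch (e + 1) m / (poch (1 / 2) (m + 1) * ((m + 1).factorial : ℂ)) * x ^ (m + 1)

lemma norm_quotTerm_le (x : ℂ) {e : ℂ} (he : ‖e‖ ≤ 1) (m : ℕ) :
    ‖quotTerm x e m‖ ≤ 2 * ‖x‖ * (‖x‖ ^ m / m.factorial) := by
  have hm : (0 : ℝ) < m.factorial := by positivity
  have hm' : (0 : ℝ) < (m + 1).factorial := by positivity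
  have h32 := factorial_le_norm_poch_three_halves m
  have hq : ‖poch (e + 1) m‖ / (‖poch (3 / 2) m‖ * (m + 1).factorial) ≤ 1 / m.factorial := by
    rw [div_le_div_iff₀ (mul_pos (hm.trans_le h32) hm') hm]
    have := mul_le_mul (norm_poch_add_one_le he m) h32 hm.le hm'.le
    linarith
  have hx : (0 : ℝ) ≤ 2 * ‖x‖ ^ (m + 1) := by positivity
  calc ‖quotTerm x e m‖
      = ‖poch (e + 1) m‖ / (‖poch (3 / 2) m‖ * (m + 1).factorial) * (2 * ‖x‖ ^ (m + 1)) := by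
        rw [quotTerm, poch_half_succ, norm_mul, norm_div, norm_mul, norm_mul, norm_pow,
          Complex.norm_natCast]
        norm_num
        ring
    _ ≤ 1 / m.factorial * (2 * ‖x‖ ^ (m + 1)) := mul_le_mul_of_nonneg_right hq hx
    _ = 2 * ‖x‖ * (‖x‖ ^ m / m.factorial) := by ring

lemma summable_quotTerm_bound (x : ℂ) :
    Summable fun m : ℕ => 2 * ‖x‖ * (‖x‖ ^ m / m.factorial) :=
  (Real.summable_pow_div_factorial ‖x‖).mul_left _

lemma continuousAt_tsum_quotTerm (x : ℂ) : ContinuousAt (fun e => ∑' m, quotTerm x e m) 0 := by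
  have h : ContinuousOn (fun e => ∑' m, quotTerm x e m) (Metric.closedBall 0 1) := by
    refine continuousOn_tsum (fun m => ?_) (summable_quotTerm_bound x)
      fun m e he => norm_quotTerm_le x (by simpa using he) m
    unfold quotTerm poch
    fun_prop
  exact h.continuousAt (Metric.closedBall_mem_nhds _ one_pos)

lemma tsum_quotTerm_zero (x : ℂ) :
    ∑' m, quotTerm x 0 m = 2 * x * hyp2F2 1 1 (3 / 2) 2 x := by
  rw [hyp2F2, ← tsum_mul_left]
  refine tsum_congr fun m => ?_
  rw [quotTerm, poch_half_succ, zero_add, poch_one, poch_two]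
  have hm : (m.factorial : ℂ) ≠ 0 := by exact_mod_cast m.factorial_ne_zero
  have hm' : ((m + 1).factorial : ℂ) ≠ 0 := by exact_mod_cast (m + 1).factorial_ne_zero
  have h32 : poch (3 / 2) m ≠ 0 := by
    have := factorial_le_norm_poch_three_halves m
    exact norm_pos_iff.1 (lt_of_lt_of_le (by positivity) this)
  field_simp
  ring

lemma hyp1F1_half_eq (x : ℂ) {e : ℂ} (he : ‖e‖ ≤ 1) :
    hyp1F1 e (1 / 2) x = 1 + e * ∑' m, quotTerm x e m := by
  have hs : Summable (quotTerm x e) :=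
    .of_norm_bounded (summable_quotTerm_bound x) (norm_quotTerm_le x he)
  have ht (m : ℕ) : poch e (m + 1) / (poch (1 / 2) (m + 1) * ((m + 1).factorial : ℂ)) * x ^ (m + 1)
      = e * quotTerm x e m := by
    rw [quotTerm, poch_succ_left e]
    ring
  rw [hyp1F1, Summable.tsum_eq_zero_add, ← tsum_mul_left]
  · simp only [ht]
    simp [poch]
  · rw [← summable_nat_add_iff 1]
    simp only [ht]
    exact hs.mul_left e

lemma hyp1F1_zero_half (x : ℂ) : hyp1F1 0 (1 / 2) x = 1 := by
  rw [hyp1F1_half_eq x (by simp), zero_mul, add_zero]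

lemma hasDerivAt_hyp1F1_half (x : ℂ) :
    HasDerivAt (fun e => hyp1F1 e (1 / 2) x) (2 * x * hyp2F2 1 1 (3 / 2) 2 x) 0 := by
  rw [hasDerivAt_iff_tendsto_slope, ← tsum_quotTerm_zero]
  refine ((continuousAt_tsum_quotTerm x).tendsto.mono_left nhdsWithin_le_nhds).congr' ?_
  filter_upwards [self_mem_nhdsWithin,
    nhdsWithin_le_nhds (Metric.closedBall_mem_nhds (0 : ℂ) one_pos)] with e he hball
  rw [slope_def_field, hyp1F1_zero_half, hyp1F1_half_eq x (by simpa using hball)]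
  have : e ≠ 0 := he
  field_simp
  ring

lemma hasDerivAt_cpow_mul_hyp1F1 {c : ℝ} (hc : 0 < c) (x : ℂ) :
    HasDerivAt (fun z : ℂ => (c : ℂ) ^ ((1 - z) / 2) * hyp1F1 ((1 - z) / 2) (1 / 2) x)
      (-(1 / 2) * (Real.log c + 2 * x * hyp2F2 1 1 (3 / 2) 2 x)) 1 := by
  have hlin : HasDerivAt (fun z : ℂ => (1 - z) / 2) (-1 / 2) 1 :=
    ((hasDerivAt_id (1 : ℂ)).const_sub 1).div_const 2
  have hpow := hlin.const_cpow (c := (c : ℂ)) (Or.inl (by exact_mod_cast hc.ne'))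
  have hF := HasDerivAt.comp (h₂ := fun e => hyp1F1 e (1 / 2) x) (1 : ℂ)
    (by simpa using hasDerivAt_hyp1F1_half x) hlin
  refine (hpow.mul hF).congr_deriv ?_
  simp only [Function.comp, sub_self, zero_div, cpow_zero, hyp1F1_zero_half, ← ofReal_log hc.le]
  ring

/-- the limit as `z → 1` of the first bracket on the right-hand side of
the generalized Ramanujan–Guinand formula. -/
theorem limit_first_bracket (w : ℂ) (a b : ℝ) (ha : 0 < a) (hb : 0 < b) :
    Filter.Tendsto
      (fun z : ℂ => (1/4) * Complex.Gamma (z/2) * riemannZeta z *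
        ((b:ℂ) ^ ((1 - z)/2) * hyp1F1 ((1 - z)/2) (1/2) (w^2/4)
          - (a:ℂ) ^ ((1 - z)/2) * hyp1F1 ((1 - z)/2) (1/2) (-w^2/4)))
      (nhdsWithin 1 {(1:ℂ)}ᶜ)
      (nhds ((Real.sqrt Real.pi : ℂ) / 8 *
        ((Real.log (a/b) : ℂ) - w^2/2 *
          (hyp2F2 1 1 (3/2) 2 (w^2/4) + hyp2F2 1 1 (3/2) 2 (-w^2/4))))) := by
  have hH := (hasDerivAt_cpow_mul_hyp1F1 hb (w ^ 2 / 4)).sub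
    (hasDerivAt_cpow_mul_hyp1F1 ha (-w ^ 2 / 4))
  have hslope := hasDerivAt_iff_tendsto_slope.1 hH
  have hΓ : Tendsto (fun z : ℂ => Complex.Gamma (z / 2)) (𝓝[≠] 1)
      (𝓝 (Real.sqrt Real.pi : ℂ)) := by
    have hval : Complex.Gamma (1 / 2) = (Real.sqrt Real.pi : ℂ) := by
      rw [← Real.Gamma_one_half_eq, ← Complex.Gamma_ofReal]
      norm_num
    have hcont : ContinuousAt (fun z : ℂ => Complex.Gamma (z / 2)) 1 := by
      refine ContinuousAt.comp (g := Complex.Gamma) ?_ (by fun_prop)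
      refine (differentiableAt_Gamma _ fun m h => ?_).continuousAt
      have := congrArg Complex.re h
      norm_num at this
      have hm : (0 : ℝ) ≤ m := m.cast_nonneg
      linarith
    rw [← hval]
    exact hcont.tendsto.mono_left nhdsWithin_le_nhds
  have hlim := ((hΓ.const_mul (1 / 4)).mul riemannZeta_residue_one).mul hslope
  rw [Real.log_div ha.ne' hb.ne']
  convert hlim.congr' ?_ using 2
  · push_cast
    ring
  · filter_upwards [self_mem_nhdsWithin] with z hz
    have hz' : z - 1 ≠ 0 := sub_ne_zero.2 hz
    rw [slope_def_field]
    simp only [Pi.sub_apply, sub_self, zero_div, cpow_zero, hyp1F1_zero_half, mul_one, sub_zero]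
    field_simp

end
end

section
/- Let $a$ and $b$ be positive real numbers with $ab=\pi^2$. Then $\sum_{n=1}^{\infty}\sigma_{-1}(n)e^{-2na}-\sum_{n=1}^{\infty}\sigma_{-1}(n)e^{-2nb}=\frac{b-a}{12}+\frac14\log\frac{a}{b}$. -/
open Complex MeasureTheory Filter

noncomputable section

lemma summable_inv_mul_pow_mul {r : ℝ} (hr : ‖r‖ < 1) :
    Summable fun p : ℕ+ × ℕ+ ↦ (p.2 : ℝ)⁻¹ * r ^ (p.1 * p.2 : ℕ) := by
  refine (summable_prod_mul_pow 0 hr).norm.of_norm_bounded fun p ↦ ?_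
  rw [pow_zero, one_mul, norm_mul]
  refine mul_le_of_le_one_left (norm_nonneg _) ?_
  rw [norm_inv, Real.norm_natCast]
  exact inv_le_one_of_one_le₀ (mod_cast p.2.2)

/-- The double series `∑ d⁻¹ r ^ (c d)` regrouped according to the value of the product `c d`. -/
lemma tsum_inv_mul_pow_mul_eq_tsum_sigmaNegOne {r : ℝ} (hr : ‖r‖ < 1) :
    ∑' p : ℕ+ × ℕ+, (p.2 : ℝ)⁻¹ * r ^ (p.1 * p.2 : ℕ) =
      ∑' n : ℕ+, sigmaNegOne n * r ^ (n : ℕ) := by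
  have hsum := sigmaAntidiagonalEquivProd.summable_iff.mpr (summable_inv_mul_pow_mul hr)
  rw [← sigmaAntidiagonalEquivProd.tsum_eq]
  refine hsum.tsum_sigma.trans (tsum_congr fun n ↦ ?_)
  rw [sigmaNegOne, Finset.sum_mul, tsum_fintype]
  refine ((n : ℕ).divisorsAntidiagonal.sum_attach
    fun x : ℕ × ℕ ↦ (x.2 : ℝ)⁻¹ * r ^ (x.1 * x.2)).trans ?_
  rw [Nat.sum_divisorsAntidiagonal' fun x y ↦ (y : ℝ)⁻¹ * r ^ (x * y)]
  exact Finset.sum_congr rfl fun d hd ↦ by rw [Nat.div_mul_cancel (Nat.dvd_of_mem_divisors hd)]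

/-- The generating series of `σ₋₁` is minus the logarithm of the Euler product. -/
lemma hasSum_log_one_sub_pow {r : ℝ} (hr : ‖r‖ < 1) :
    HasSum (fun n : ℕ ↦ Real.log (1 - r ^ (n + 1)))
      (-∑' n : ℕ, sigmaNegOne (n + 1) * r ^ (n + 1)) := by
  have hlog (c : ℕ+) : HasSum (fun d : ℕ+ ↦ (d : ℝ)⁻¹ * r ^ (c * d : ℕ))
      (-Real.log (1 - r ^ (c : ℕ))) := by
    have hc : |r ^ (c : ℕ)| < 1 := by
      rw [abs_pow]
      exact pow_lt_one₀ (abs_nonneg _) hr c.ne_zero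
    rw [← Equiv.pnatEquivNat.symm.hasSum_iff]
    refine (Real.hasSum_pow_div_log_of_abs_lt_one hc).congr_fun fun d ↦ ?_
    simp [pow_mul, div_eq_inv_mul]
  have h := ((summable_inv_mul_pow_mul hr).hasSum.prod_fiberwise hlog).neg
  rw [tsum_inv_mul_pow_mul_eq_tsum_sigmaNegOne hr,
    tsum_pnat_eq_tsum_succ (f := fun n ↦ sigmaNegOne n * r ^ n),
    ← Equiv.pnatEquivNat.symm.hasSum_iff] at h
  simpa [Function.comp_def] using h

/-- The Dedekind eta function on the imaginary axis, as the exponential of a series. -/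
lemma norm_eta_mul_I {t : ℝ} (ht : 0 < t) :
    ‖ModularForm.eta (t / Real.pi * I)‖ = Real.exp
      (-t / 12 - ∑' n : ℕ, sigmaNegOne (n + 1) * Real.exp (-2 * ((n : ℝ) + 1) * t)) := by
  have hr₀ : Real.exp (-2 * t) < 1 := Real.exp_lt_one_iff.mpr (by linarith)
  have hr : ‖Real.exp (-2 * t)‖ < 1 := by rwa [Real.norm_of_nonneg (Real.exp_nonneg _)]
  have hpow (n : ℕ) : Real.exp (-2 * ((n : ℝ) + 1) * t) = Real.exp (-2 * t) ^ (n + 1) := by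
    rw [← Real.exp_nat_mul]
    push_cast
    ring_nf
  have hπ : (Real.pi : ℂ) ≠ 0 := mod_cast Real.pi_ne_zero
  have hq (n : ℕ) : 1 - ModularForm.eta_q n (t / Real.pi * I) =
      ((1 - Real.exp (-2 * t) ^ (n + 1) : ℝ) : ℂ) := by
    rw [ModularForm.eta_q_eq_pow]
    push_cast
    congr 3
    field_simp
    rw [I_sq]
    ring
  have hprod := Real.hasProd_of_hasSum_log
    (fun n ↦ sub_pos.mpr (pow_lt_one₀ (Real.exp_nonneg _) hr₀ n.succ_ne_zero))
    (hasSum_log_one_sub_pow hr)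
  have hprod' := hprod.map Complex.ofRealHom Complex.continuous_ofReal
  simp only [Function.comp_def, Complex.ofRealHom_eq_coe] at hprod'
  have hparam : ‖Function.Periodic.qParam 24 (t / Real.pi * I)‖ = Real.exp (-t / 12) := by
    rw [Function.Periodic.norm_qParam]
    congr 1
    simp [← ofReal_div]
    field_simp
    norm_num
  simp only [hpow, ModularForm.eta, hq, norm_mul, hparam, hprod'.tprod_eq, norm_real]
  rw [Real.norm_of_nonneg (Real.exp_nonneg _), ← Real.exp_add, sub_eq_add_neg]

lemma norm_sqrt (z : ℂ) : ‖Complex.sqrt z‖ = √‖z‖ := by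
  rw [eq_comm, Real.sqrt_eq_iff_eq_sq (norm_nonneg _) (norm_nonneg _), ← norm_pow, Complex.sqrt]
  congr 1
  exact (Complex.cpow_nat_inv_pow z two_ne_zero).symm

/-- The transformation of the Dedekind eta function under `z ↦ -1 / z` on the imaginary axis. -/
lemma norm_eta_mul_I_of_mul_eq {a b : ℝ} (ha : 0 < a) (hab : a * b = Real.pi ^ 2) :
    ‖ModularForm.eta (b / Real.pi * I)‖ =
      √(a / Real.pi) * ‖ModularForm.eta (a / Real.pi * I)‖ := by
  have hpos : 0 < a / Real.pi := div_pos ha Real.pi_pos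
  have hmem : (a / Real.pi * I : ℂ) ∈ UpperHalfPlane.upperHalfPlaneSet := by
    simpa [UpperHalfPlane.upperHalfPlaneSet, ← ofReal_div] using hpos
  have hinv : -1 / (a / Real.pi * I : ℂ) = b / Real.pi * I := by
    have hπ : (Real.pi : ℂ) ≠ 0 := mod_cast Real.pi_ne_zero
    have ha' : (a : ℂ) ≠ 0 := mod_cast ha.ne'
    have hab' : (a * b : ℂ) = Real.pi ^ 2 := mod_cast hab
    field_simp
    rw [I_sq]
    linear_combination hab'
  have h := congrArg norm (ModularForm.eta_comp_eq_csqrt_I_inv hmem)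
  simp only [Function.comp_apply, hinv, Pi.smul_apply, Pi.mul_apply, smul_eq_mul, norm_mul,
    norm_inv, norm_sqrt, norm_I, Real.sqrt_one, inv_one, one_mul, mul_one] at h
  rw [h, ← ofReal_div, norm_real, Real.norm_of_nonneg hpos.le]

/-- Ramanujan's transformation formula for the logarithm of the
Dedekind eta function. -/
theorem ramanujan_eta_transformation (a b : ℝ) (ha : 0 < a) (hb : 0 < b)
    (hab : a * b = Real.pi ^ 2) :
    (∑' n : ℕ, sigmaNegOne (n+1) * Real.exp (-2 * ((n:ℝ)+1) * a))
      - (∑' n : ℕ, sigmaNegOne (n+1) * Real.exp (-2 * ((n:ℝ)+1) * b))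
    = (b - a) / 12 + 1/4 * Real.log (a/b) := by
  have hπ := Real.pi_pos
  have h := norm_eta_mul_I_of_mul_eq ha hab
  rw [norm_eta_mul_I ha, norm_eta_mul_I hb] at h
  have h' := congrArg Real.log h
  rw [Real.log_mul (by positivity) (by positivity), Real.log_exp, Real.log_exp,
    Real.log_sqrt (by positivity)] at h'
  have hdiv : a / b = (a / Real.pi) ^ 2 := by
    field_simp
    linarith
  rw [hdiv, Real.log_pow]
  push_cast
  linarith

end
end
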